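/- arXiv:1202.5715 — 2 statements merged into one kernel-verified Lean document; each statement's English description precedes it below -/
import Mathlib

section
/- Let K, a, b, φ, E be as in the ear setting (so E is a negative-sloped ear of K). Let c, d ∈ ℝ² with c.x < d.x and c.y < d.y (a positive-sloped segment), such that c ∉ interior E, d ∉ interior E, and the closed segment [c, d] is disjoint from the open segment between a and b. Then [c, d] is disjoint from the interior of E. (Lemma 1 of the paper in contrapositive form: a positive-sloped line segment cannot penetrate a negative-sloped ear.) -/
open scoped ENNReal

noncomputable section

/-- The plane with the `L1` metric. -/
abbrev Plane : Type := WithLp 1 (ℝ × ℝ)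

/-- The `x`-coordinate of a point of the `L1` plane. -/
def px (p : Plane) : ℝ := (WithLp.equiv 1 (ℝ × ℝ) p).1

/-- The `y`-coordinate of a point of the `L1` plane. -/
def py (p : Plane) : ℝ := (WithLp.equiv 1 (ℝ × ℝ) p).2

@[simp] lemma px_add (p q : Plane) : px (p + q) = px p + px q := rfl

@[simp] lemma py_add (p q : Plane) : py (p + q) = py p + py q := rfl

@[simp] lemma px_sub (p q : Plane) : px (p - q) = px p - px q := rfl

@[simp] lemma py_sub (p q : Plane) : py (p - q) = py p - py q := rfl

@[simp] lemma px_smul (r : ℝ) (p : Plane) : px (r • p) = r * px p := rfl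

@[simp] lemma py_smul (r : ℝ) (p : Plane) : py (r • p) = r * py p := rfl

lemma plane_ext {p q : Plane} (h₁ : px p = px q) (h₂ : py p = py q) : p = q :=
  (WithLp.equiv 1 (ℝ × ℝ)).injective (Prod.ext h₁ h₂)

/-- From an interior point one can move a little in any direction without leaving the set. -/
lemma exists_pos_sub_smul_mem_of_mem_interior {s : Set Plane} {p : Plane}
    (hp : p ∈ interior s) (v : Plane) : ∃ ε : ℝ, 0 < ε ∧ p - ε • v ∈ s := by
  have hcont : Continuous fun ε : ℝ => p - ε • v := by fun_prop
  have hmem : (fun ε : ℝ => p - ε • v) ⁻¹' interior s ∈ nhds (0 : ℝ) :=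
    (isOpen_interior.preimage hcont).mem_nhds (by simpa using hp)
  obtain ⟨δ, hδ, hball⟩ := Metric.mem_nhds_iff.1 hmem
  refine ⟨δ / 2, by positivity, interior_subset (hball ?_)⟩
  rw [Metric.mem_ball, Real.dist_eq, sub_zero, abs_of_pos (by positivity)]
  linarith

/-- A point of the line through the ends of a negative-sloped chord lies in the open chord as soon
as it lies strictly to the right of the left end and strictly above the bottom end. -/
lemma mem_openSegment_of_mem_line {a b q : Plane} (hx : px b < px a) (hy : py a < py b)
    (hq : (py b - py a) * (px q - px a) + (px a - px b) * (py q - py a) = 0)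
    (hqx : px b < px q) (hqy : py a < py q) : q ∈ openSegment ℝ a b := by
  have hX : 0 < px a - px b := sub_pos.2 hx
  have hY : 0 < py b - py a := sub_pos.2 hy
  have hlt : (py q - py a) / (py b - py a) < 1 := by
    rw [div_lt_one hY]
    nlinarith
  refine ⟨1 - (py q - py a) / (py b - py a), (py q - py a) / (py b - py a),
    sub_pos.2 hlt, div_pos (sub_pos.2 hqy) hY, by ring, plane_ext ?_ ?_⟩
  · simp only [px_add, px_smul]
    field_simp
    linarith
  · simp only [py_add, py_smul]
    field_simp
    ring

/-- The part of a convex set on the southwest side of a line is convex. -/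
lemma convex_inter_halfPlane {K : Set Plane} (hK : Convex ℝ K) (a b : Plane) :
    Convex ℝ (K ∩ {q | (py b - py a) * (px q - px a) + (px a - px b) * (py q - py a) ≤ 0}) := by
  refine hK.inter fun p hp q hq s t hs ht hst => ?_
  simp only [Set.mem_ofPred_eq, px_add, px_smul, py_add, py_smul] at hp hq ⊢
  obtain rfl : s = 1 - t := by linarith
  nlinarith [mul_nonneg hs (neg_nonneg.2 hp), mul_nonneg ht (neg_nonneg.2 hq)]

/-- A positive-sloped segment cannot penetrate a negative-sloped ear: if a segment
`[c,d]` with `c` strictly southwest of `d` has neither endpoint in the interior of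
the ear `E` and avoids the open chord between `a` and `b`, then it is disjoint
from the interior of `E`. -/
theorem positive_sloped_segment_not_penetrates_negative_ear
    (K : Set Plane) (hKc : IsCompact K) (hKconv : Convex ℝ K)
    (a b : Plane) (ha : a ∈ K) (hb : b ∈ K)
    (hay : ∀ q ∈ K, py a ≤ py q) (hbx : ∀ q ∈ K, px b ≤ px q)
    (hx : px b < px a) (hy : py a < py b)
    (E : Set Plane)
    (hE : E = K ∩ {q | (py b - py a) * (px q - px a) + (px a - px b) * (py q - py a) ≤ 0})
    (c d : Plane) (hcdx : px c < px d) (hcdy : py c < py d)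
    (hc : c ∉ interior E) (hd : d ∉ interior E)
    (hchord : Disjoint (segment ℝ c d) (openSegment ℝ a b)) :
    Disjoint (segment ℝ c d) (interior E) := by
  rw [Set.disjoint_left]
  intro p hp hpE
  obtain ⟨t, ⟨ht0, ht1⟩, hpt⟩ := (segment_eq_image' ℝ c d ▸ hp :)
  have hpt : c + t • (d - c) = p := hpt
  have hX : 0 < px a - px b := sub_pos.2 hx
  have hY : 0 < py b - py a := sub_pos.2 hy
  have hvx : 0 < px d - px c := sub_pos.2 hcdx
  have hvy : 0 < py d - py c := sub_pos.2 hcdy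
  obtain ⟨ε, hε, hback⟩ := exists_pos_sub_smul_mem_of_mem_interior hpE (d - c)
  have hpmem := interior_subset hpE
  rw [hE] at hback hpmem
  have hbackx := hbx _ hback.1
  have hbacky := hay _ hback.1
  simp only [px_sub, px_smul, py_sub, py_smul] at hbackx hbacky
  have hpx : px b < px p := by nlinarith [mul_pos hε hvx]
  have hpy : py a < py p := by nlinarith [mul_pos hε hvy]
  have hslope : 0 < (py b - py a) * (px d - px c) + (px a - px b) * (py d - py c) := by positivity
  obtain ⟨s, hs⟩ : ∃ s : ℝ, s = -((py b - py a) * (px p - px a) + (px a - px b) * (py p - py a)) /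
    ((py b - py a) * (px d - px c) + (px a - px b) * (py d - py c)) := ⟨_, rfl⟩
  have hs0 : 0 ≤ s := hs ▸ div_nonneg (neg_nonneg.2 hpmem.2) hslope.le
  rw [eq_div_iff hslope.ne'] at hs
  have hqchord : p + s • (d - c) ∈ openSegment ℝ a b := by
    apply mem_openSegment_of_mem_line hx hy <;>
      simp only [px_add, px_sub, px_smul, py_add, py_sub, py_smul]
    · linarith
    · nlinarith [mul_nonneg hs0 hvx.le]
    · nlinarith [mul_nonneg hs0 hvy.le]
  by_cases hts : t + s ≤ 1
  · refine Set.disjoint_left.1 hchord ?_ hqchord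
    rw [segment_eq_image']
    refine ⟨t + s, ⟨by linarith, hts⟩, ?_⟩
    change c + (t + s) • (d - c) = _
    rw [← hpt]
    module
  · push Not at hts
    have hspos : 0 < s := by linarith
    have hqE : p + s • (d - c) ∈ E := by
      rw [hE]
      refine ⟨hKconv.openSegment_subset ha hb hqchord, ?_⟩
      simp only [Set.mem_ofPred_eq, px_add, px_sub, px_smul, py_add, py_sub, py_smul]
      linarith
    have hEconv : Convex ℝ E := hE ▸ convex_inter_halfPlane hKconv a b
    have hr : (1 - t) / s < 1 := by
      rw [div_lt_one hspos]
      linarith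
    have hmem := hEconv.combo_interior_self_mem_interior hpE hqE (sub_pos.2 hr)
      (div_nonneg (sub_nonneg.2 ht1) hspos.le) (by ring)
    refine hd ?_
    convert hmem using 1
    apply plane_ext <;> rw [← hpt] <;>
      simp only [px_add, px_sub, px_smul, py_add, py_sub, py_smul] <;> field_simp <;> ring
end
end

section
/- Let (p₁, w₁) and (p₂, w₂) be weighted sites in the L1 plane with p₁.x ≤ p₂.x and p₁.y ≤ p₂.y. Then for every q ∈ ℝ² lying in the closed coordinate rectangle spanned by p₁ and p₂ (i.e., p₁.x ≤ q.x ≤ p₂.x and p₁.y ≤ q.y ≤ p₂.y), one has w₁ + dist₁(q, p₁) = w₂ + dist₁(q, p₂) if and only if 2·(q.x + q.y) = p₁.x + p₁.y + p₂.x + p₂.y + w₂ − w₁. In particular, the part of the weighted L1 bisector inside the rectangle is contained in a single line of slope −1. (The middle-segment claim of Observation 2 of the paper.) -/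
open scoped ENNReal

noncomputable section

/-- The distance of the plane is the sum of the coordinate distances. -/
theorem dist_eq_abs_add_abs (p q : Plane) :
    dist p q = |px p - px q| + |py p - py q| := by
  rw [WithLp.prod_dist_eq_add (by norm_num)]
  simp [px, py, Real.dist_eq]

/-- Inside the closed coordinate rectangle spanned by two weighted sites, the
weighted `L1` bisector is given by the slope `-1` line
`2(x + y) = p₁.x + p₁.y + p₂.x + p₂.y + w₂ - w₁`. -/
theorem weighted_bisector_middle_segment (p₁ p₂ : Plane) (w₁ w₂ : ℝ)
    (hx : px p₁ ≤ px p₂) (hy : py p₁ ≤ py p₂) :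
    ∀ q : Plane, px p₁ ≤ px q → px q ≤ px p₂ → py p₁ ≤ py q → py q ≤ py p₂ →
      (w₁ + dist q p₁ = w₂ + dist q p₂ ↔
        2 * (px q + py q) = px p₁ + py p₁ + px p₂ + py p₂ + w₂ - w₁) := by
  intro q hx₁ hx₂ hy₁ hy₂
  rw [dist_eq_abs_add_abs, dist_eq_abs_add_abs, abs_of_nonneg (sub_nonneg.2 hx₁),
    abs_of_nonneg (sub_nonneg.2 hy₁), abs_of_nonpos (sub_nonpos.2 hx₂),
    abs_of_nonpos (sub_nonpos.2 hy₂)]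
  constructor <;> intro h <;> linarith
end
end
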